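/- Let k be a field of characteristic zero, n ≥ 1, and let J ∈ M_n(k) be the nilpotent Jordan block (ones on the superdiagonal, zeros elsewhere). Let B ∈ M_n(k) satisfy JB − BJ = B², and let i ≥ 1 be an integer such that B_{n−j,n} = 0 for all 1 ≤ j ≤ i−1. Then B_{s,t} = 0 for all indices 1 ≤ s < t ≤ n with 1 ≤ t − s ≤ i−1. -/

import Mathlib

/-- If `JB - BJ = B²`, then `J` acts on the powers of `B` as the derivation `B² d/dB`. -/
lemma commutator_pow_of_commutator_eq_sq {R : Type*} [Ring R] {J B : R}
    (hB : J * B - B * J = B ^ 2) (r : ℕ) :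
    J * B ^ r - B ^ r * J = (r : R) * B ^ (r + 1) := by
  induction r with
  | zero => simp
  | succ r ih =>
    calc J * B ^ (r + 1) - B ^ (r + 1) * J
        = (J * B ^ r - B ^ r * J) * B + B ^ r * (J * B - B * J) := by
          rw [pow_succ]; noncomm_ring
      _ = ((r + 1 : ℕ) : R) * B ^ (r + 1 + 1) := by
          rw [ih, hB, ← pow_add, mul_assoc, ← pow_succ]; push_cast; rw [add_mul, one_mul]

/-- If `J` is nilpotent and `JB - BJ = B²`, then `B` is nilpotent in characteristic zero. -/
lemma isNilpotent_of_commutator_eq_sq {k A : Type*} [Field k] [CharZero k] [Ring A] [Algebra k A]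
    {J B : A} (hJ : IsNilpotent J) (hB : J * B - B * J = B ^ 2) : IsNilpotent B := by
  obtain ⟨N, hN⟩ : IsNilpotent (LinearMap.mulLeft k J - LinearMap.mulRight k J) :=
    (LinearMap.commute_mulLeft_right J J).isNilpotent_sub
      ((LinearMap.isNilpotent_mulLeft_iff k J).mpr hJ)
      ((LinearMap.isNilpotent_mulRight_iff k J).mpr hJ)
  have key : ∀ r : ℕ, ((LinearMap.mulLeft k J - LinearMap.mulRight k J) ^ r) B =
      (r.factorial : k) • B ^ (r + 1) := by
    intro r
    induction r with
    | zero => simp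
    | succ r ih =>
      rw [pow_succ', Module.End.mul_apply, ih, map_smul, LinearMap.sub_apply,
        LinearMap.mulLeft_apply, LinearMap.mulRight_apply, commutator_pow_of_commutator_eq_sq hB, Nat.factorial_succ, mul_comm, Nat.cast_mul,
        mul_smul, ← nsmul_eq_mul, Nat.cast_smul_eq_nsmul k (r + 1)]
  have h := key N
  rw [hN, LinearMap.zero_apply] at h
  exact ⟨N + 1, (smul_eq_zero.mp h.symm).resolve_left (by exact_mod_cast N.factorial_ne_zero)⟩

section JordanBlock

variable {k : Type*} [Field k] {n : ℕ} {J : Matrix (Fin n) (Fin n) k}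

lemma jordanBlock_mul_apply
    (hJ : ∀ i j : Fin n, J i j = if (i : ℕ) + 1 = (j : ℕ) then 1 else 0)
    (M : Matrix (Fin n) (Fin n) k) {a a' : Fin n} (h : (a : ℕ) + 1 = a') (b : Fin n) :
    (J * M) a b = M a' b := by
  rw [Matrix.mul_apply, Finset.sum_eq_single a']
  · simp [hJ, h]
  · intro c _ hc
    rw [hJ, if_neg (fun h' => hc (Fin.ext (by omega))), zero_mul]
  · simp

lemma mul_jordanBlock_apply
    (hJ : ∀ i j : Fin n, J i j = if (i : ℕ) + 1 = (j : ℕ) then 1 else 0)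
    (M : Matrix (Fin n) (Fin n) k) (a : Fin n) {b b' : Fin n} (h : (b' : ℕ) + 1 = b) :
    (M * J) a b = M a b' := by
  rw [Matrix.mul_apply, Finset.sum_eq_single b']
  · simp [hJ, h]
  · intro c _ hc
    rw [hJ, if_neg (fun h' => hc (Fin.ext (by omega))), mul_zero]
  · simp

lemma mul_jordanBlock_apply_zero
    (hJ : ∀ i j : Fin n, J i j = if (i : ℕ) + 1 = (j : ℕ) then 1 else 0)
    (M : Matrix (Fin n) (Fin n) k) (a : Fin n) {b : Fin n} (h : (b : ℕ) = 0) :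
    (M * J) a b = 0 := by
  rw [Matrix.mul_apply]
  refine Finset.sum_eq_zero fun c _ => ?_
  rw [hJ, if_neg (by omega), mul_zero]

lemma isNilpotent_jordanBlock
    (hJ : ∀ i j : Fin n, J i j = if (i : ℕ) + 1 = (j : ℕ) then 1 else 0) :
    IsNilpotent J := by
  have key : ∀ (r : ℕ) (a b : Fin n), (b : ℕ) < a + r → (J ^ r) a b = 0 := by
    intro r
    induction r with
    | zero =>
      intro a b h
      rw [pow_zero, Matrix.one_apply_ne (fun h' => by subst h'; omega)]
    | succ r ih =>
      intro a b h
      rw [pow_succ]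
      rcases Nat.eq_zero_or_pos (b : ℕ) with hb | hb
      · exact mul_jordanBlock_apply_zero hJ _ _ hb
      · rw [mul_jordanBlock_apply hJ _ a (b' := ⟨b - 1, by omega⟩) (by simp; omega)]
        exact ih _ _ (by simp; omega)
  exact ⟨n, by ext a b; exact key n a b (by omega)⟩

/-- Over a field of characteristic zero, every solution of `JB - BJ = B²` with `J` a nilpotent
Jordan block is strictly upper triangular. -/
lemma strictUpper_of_commutator_eq_sq [CharZero k]
    (hJ : ∀ i j : Fin n, J i j = if (i : ℕ) + 1 = (j : ℕ) then 1 else 0)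
    {B : Matrix (Fin n) (Fin n) k} (hB : J * B - B * J = B ^ 2)
    (b a : Fin n) (hab : b ≤ a) : B a b = 0 := by
  obtain ⟨N, hN⟩ := isNilpotent_of_commutator_eq_sq (k := k) (isNilpotent_jordanBlock hJ) hB
  induction b using WellFoundedLT.induction generalizing a with
  | ind m ih =>
  have hlow : ∀ (r : ℕ) (a b : Fin n), b < m → m ≤ a → (B ^ r) a b = 0 := by
    intro r
    induction r with
    | zero =>
      intro a b hb ha
      rw [pow_zero, Matrix.one_apply_ne (hb.trans_le ha).ne']
    | succ r ihr =>
      intro a b hb ha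
      rw [pow_succ', Matrix.mul_apply]
      refine Finset.sum_eq_zero fun c _ => ?_
      rcases lt_or_ge c m with hc | hc
      · rw [ih c hc a (hc.le.trans ha), zero_mul]
      · rw [ihr c b hb hc, mul_zero]
  classical
  have hex : ∃ r, ∀ a, m ≤ a → (B ^ r) a m = 0 := ⟨N, fun a _ => by simp [hN]⟩
  have hspec := Nat.find_spec hex
  have hmin := fun r => Nat.find_min hex (m := r)
  generalize Nat.find hex = R at hspec hmin
  match R with
  | 0 => simpa using hspec m le_rfl
  | 1 => simpa using hspec a hab
  | r + 2 =>
    have hbelow : ∀ a, m < a → (B ^ (r + 1)) a m = 0 := by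
      intro a ha
      have ha' : (m : ℕ) < a := ha
      have hle : m ≤ ⟨a - 1, by omega⟩ := Fin.le_def.mpr (by simp; omega)
      have h := congrFun₂ (commutator_pow_of_commutator_eq_sq hB (r + 1)) ⟨a - 1, by omega⟩ m
      rw [Matrix.sub_apply, jordanBlock_mul_apply hJ _ (a' := a) (by simp; omega),
        ← nsmul_eq_mul, Matrix.smul_apply, hspec _ hle, smul_zero] at h
      rcases Nat.eq_zero_or_pos (m : ℕ) with hm | hm
      · rwa [mul_jordanBlock_apply_zero hJ _ _ hm, sub_zero] at h
      · rwa [mul_jordanBlock_apply hJ _ _ (b' := ⟨m - 1, by omega⟩) (by simp; omega),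
          hlow _ _ _ (Fin.lt_def.mpr (by simp; omega)) hle, sub_zero] at h
    have hdiag : ∀ q : ℕ, ((B ^ (r + 1)) ^ q) m m = ((B ^ (r + 1)) m m) ^ q := by
      intro q
      induction q with
      | zero => simp
      | succ q ihq =>
        rw [pow_succ (B ^ (r + 1)), Matrix.mul_apply, Finset.sum_eq_single m, ihq,
          ← pow_succ (_ : k)]
        · intro c _ hc
          rcases lt_or_gt_of_ne hc with hc | hc
          · rw [← pow_mul, hlow _ _ _ hc le_rfl, zero_mul]
          · rw [hbelow c hc, mul_zero]
        · simp
    have hzero : (B ^ (r + 1)) m m = 0 := by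
      have h := hdiag N
      rw [← pow_mul, mul_comm, pow_mul, hN, zero_pow (Nat.succ_ne_zero r),
        Matrix.zero_apply] at h
      exact eq_zero_of_pow_eq_zero h.symm
    refine absurd (fun a ha => ?_) (hmin (r + 1) (by omega))
    rcases eq_or_lt_of_le ha with rfl | ha
    · exact hzero
    · exact hbelow a ha

end JordanBlock

theorem stmt_15 (k : Type*) [Field k] [CharZero k] (n : ℕ) (hn : 1 ≤ n)
    (J B : Matrix (Fin n) (Fin n) k)
    (hJ : ∀ i j : Fin n, J i j = if (i : ℕ) + 1 = (j : ℕ) then 1 else 0)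
    (hB : J * B - B * J = B ^ 2)
    (i : ℕ) (hi : 1 ≤ i)
    (hzero : ∀ j : ℕ, 1 ≤ j → j ≤ i - 1 →
      B ⟨n - j - 1, by omega⟩ ⟨n - 1, by omega⟩ = 0) :
    ∀ (s t : ℕ) (hs : 1 ≤ s) (hst : s < t) (htn : t ≤ n) (hts : t - s ≤ i - 1),
      B ⟨s - 1, by omega⟩ ⟨t - 1, by omega⟩ = 0 := by
  have key : ∀ d : ℕ, d ≤ i - 1 → ∀ a b : Fin n, (b : ℕ) ≤ a + d → B a b = 0 := by
    intro d
    induction d with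
    | zero => exact fun _ a b h => strictUpper_of_commutator_eq_sq hJ hB b a (by simpa using h)
    | succ d ih =>
      intro hd
      have ihd := ih (by omega)
      have hdiag : ∀ q : ℕ, ∀ a b : Fin n, (b : ℕ) + q + 1 = n → (b : ℕ) = a + (d + 1) →
          B a b = 0 := by
        intro q
        induction q with
        | zero =>
          intro a b hb hab
          have h := hzero (d + 1) (by omega) hd
          convert h using 2 <;> exact Fin.ext (by simp; omega)
        | succ q ihq =>
          intro a b hb hab
          have hnext : B ⟨a + 1, by omega⟩ ⟨b + 1, by omega⟩ = 0 :=
            ihq _ _ (by simp; omega) (by simp; omega)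
          have h := congrFun₂ hB a ⟨b + 1, by omega⟩
          rw [Matrix.sub_apply, jordanBlock_mul_apply hJ _ (a' := ⟨a + 1, by omega⟩) rfl,
            mul_jordanBlock_apply hJ _ _ (b' := b) rfl, hnext, zero_sub, pow_two,
            Matrix.mul_apply, Finset.sum_eq_zero, neg_eq_zero] at h
          · exact h
          · intro c _
            rcases le_or_gt (c : ℕ) (a + d) with hc | hc
            · rw [ihd a c hc, zero_mul]
            · rcases Nat.eq_zero_or_pos d with hd0 | hd0
              · rcases eq_or_ne (c : ℕ) (a + 1) with hc1 | hc1
                · rw [show c = ⟨a + 1, by omega⟩ from Fin.ext hc1, hnext, mul_zero]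
                · rw [ihd c _ (by simp; omega), mul_zero]
              · rw [ihd c _ (by simp; omega), mul_zero]
      intro a b hab
      rcases Nat.lt_or_ge (a + d) b with h | h
      · exact hdiag (n - 1 - b) a b (by omega) (by omega)
      · exact ihd a b h
  intro s t hs hst htn hts
  exact key (t - s) hts _ _ (by simp; omega)
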